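/- Let 0 < s < 2 and define C(s) := ∫_ℝ ∫_ℝ |v|^{1-s} / (((u+v)² + 1)(u² + 1)) du dv. Then 0 < C(s) < ∞, and for every ρ > 0 the Gagliardo seminorm of order s/2 of K_ρ(y) = 1/(y+iρ) satisfies ∫_ℝ ∫_ℝ |K_ρ(y+h) − K_ρ(y)|² · |h|^{-1-s} dh dy = C(s) · ρ^{-1-s}. -/

import Mathlib

open MeasureTheory Real

lemma integrable_of_even_of_integrableOn_Ioi {f : ℝ → ℝ} (heven : ∀ x, f (-x) = f x)
    (hf : IntegrableOn f (Set.Ioi 0)) : Integrable f := by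
  rw [← integrableOn_univ, ← @Set.Iio_union_Ici _ _ (0 : ℝ), integrableOn_union,
    integrableOn_Ici_iff_integrableOn_Ioi]
  refine ⟨?_, hf⟩
  rw [← (Measure.measurePreserving_neg (volume : Measure ℝ)).integrableOn_comp_preimage
    (Homeomorph.neg ℝ).measurableEmbedding]
  simpa [Function.comp_def, heven] using hf

lemma integrable_abs_rpow_div_one_add_sq {a : ℝ} (ha : -1 < a) (ha' : a < 1) :
    Integrable fun v : ℝ => |v| ^ a / (1 + v ^ 2) := by
  have hmeas : Measurable fun v : ℝ => |v| ^ a / (1 + v ^ 2) := by fun_prop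
  apply integrable_of_even_of_integrableOn_Ioi (by simp)
  rw [← Set.Ioc_union_Ioi_eq_Ioi (zero_le_one' ℝ), integrableOn_union]
  constructor
  · have h := (intervalIntegral.intervalIntegrable_rpow' (a := 0) (b := 1) ha).1
    refine h.mono' hmeas.aestronglyMeasurable ?_
    filter_upwards [ae_restrict_mem measurableSet_Ioc] with v hv
    have hv0 : 0 ≤ v ^ a := rpow_nonneg hv.1.le a
    rw [abs_of_pos hv.1, norm_of_nonneg (by positivity)]
    exact div_le_self hv0 (by nlinarith [sq_nonneg v])
  · have h := integrableOn_Ioi_rpow_of_lt (a := a - 2) (by linarith) zero_lt_one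
    refine h.mono' hmeas.aestronglyMeasurable ?_
    filter_upwards [ae_restrict_mem measurableSet_Ioi] with v hv
    have hv0 : 0 < v := zero_lt_one.trans hv
    have hva : 0 ≤ v ^ a := rpow_nonneg hv0.le a
    rw [abs_of_pos hv0, norm_of_nonneg (by positivity), rpow_sub hv0, rpow_two]
    gcongr
    linarith

lemma inv_mul_inv_one_add_sq_le (u v : ℝ) :
    1 / (((u + v) ^ 2 + 1) * (u ^ 2 + 1))
      ≤ 2 / (1 + v ^ 2) * ((1 + u ^ 2)⁻¹ + (1 + (v + u) ^ 2)⁻¹) := by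
  have h : 2 / (1 + v ^ 2) * ((1 + u ^ 2)⁻¹ + (1 + (v + u) ^ 2)⁻¹)
      = 2 * ((1 + u ^ 2) + (1 + (u + v) ^ 2)) / (1 + v ^ 2)
        * (1 / (((u + v) ^ 2 + 1) * (u ^ 2 + 1))) := by
    field_simp
    ring
  rw [h]
  apply le_mul_of_one_le_left (by positivity)
  rw [one_le_div (by positivity)]
  nlinarith [sq_nonneg (u + (u + v))]

lemma integrable_szego_gagliardo_kernel {s : ℝ} (hs0 : 0 < s) (hs2 : s < 2) :
    Integrable (fun p : ℝ × ℝ =>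
      |p.2| ^ (1 - s) / (((p.1 + p.2) ^ 2 + 1) * (p.1 ^ 2 + 1))) := by
  have hφ := integrable_abs_rpow_div_one_add_sq (a := 1 - s) (by linarith) (by linarith)
  have hprod := hφ.mul_prod integrable_inv_one_add_sq
  have hswap := (Measure.measurePreserving_swap
    (μ := (volume : Measure ℝ)) (ν := (volume : Measure ℝ))).integrable_comp_of_integrable hprod
  have hshear := (measurePreserving_prod_add_swap
    (volume : Measure ℝ) (volume : Measure ℝ)).integrable_comp_of_integrable hprod
  refine ((hswap.add hshear).const_mul 2).mono'
    (Measurable.aestronglyMeasurable (by fun_prop)) (ae_of_all _ ?_)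
  rintro ⟨u, v⟩
  have hv : 0 ≤ |v| ^ (1 - s) := by positivity
  rw [norm_of_nonneg (by positivity)]
  have := mul_le_mul_of_nonneg_left (inv_mul_inv_one_add_sq_le u v) hv
  simp only [Pi.add_apply, Function.comp_apply, Prod.fst_swap, Prod.snd_swap]
  calc _ = |v| ^ (1 - s) * (1 / (((u + v) ^ 2 + 1) * (u ^ 2 + 1))) := by ring
    _ ≤ _ := this
    _ = _ := by ring

lemma integral_szego_gagliardo_kernel_pos {s : ℝ} (hs0 : 0 < s) (hs2 : s < 2) :
    0 < ∫ p : ℝ × ℝ, |p.2| ^ (1 - s) / (((p.1 + p.2) ^ 2 + 1) * (p.1 ^ 2 + 1)) := by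
  rw [integral_pos_iff_support_of_nonneg (fun p => by positivity)
    (integrable_szego_gagliardo_kernel hs0 hs2)]
  have hsub : Set.Ioi (0 : ℝ) ×ˢ Set.Ioi (0 : ℝ) ⊆ Function.support (fun p : ℝ × ℝ =>
      |p.2| ^ (1 - s) / (((p.1 + p.2) ^ 2 + 1) * (p.1 ^ 2 + 1))) := by
    rintro ⟨u, v⟩ ⟨-, hv⟩
    have hv' : 0 < |v| := abs_pos.2 (ne_of_gt hv)
    exact ne_of_gt (by positivity)
  refine lt_of_lt_of_le ?_ (measure_mono hsub)
  rw [Measure.volume_eq_prod, Measure.prod_prod]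
  simp

lemma norm_szego_profile_sub_sq {ρ : ℝ} (hρ : 0 < ρ) (y h : ℝ) :
    ‖(1 : ℂ) / (((y + h : ℝ) : ℂ) + (ρ : ℂ) * Complex.I)
        - (1 : ℂ) / ((y : ℂ) + (ρ : ℂ) * Complex.I)‖ ^ 2
      = h ^ 2 / (((y + h) ^ 2 + ρ ^ 2) * (y ^ 2 + ρ ^ 2)) := by
  have hne : ∀ x : ℝ, (x : ℂ) + (ρ : ℂ) * Complex.I ≠ 0 := fun x hx => by
    have := congrArg Complex.im hx
    simp at this
    exact hρ.ne' this
  have hnorm : ∀ x : ℝ, ‖(x : ℂ) + (ρ : ℂ) * Complex.I‖ ^ 2 = x ^ 2 + ρ ^ 2 := fun x => by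
    rw [← Complex.normSq_eq_norm_sq, Complex.normSq_add_mul_I]
  rw [div_sub_div _ _ (hne _) (hne _), norm_div, norm_mul, div_pow, mul_pow, hnorm, hnorm]
  congr 1
  have : 1 * ((y : ℂ) + ρ * Complex.I) - (((y + h : ℝ) : ℂ) + ρ * Complex.I) * 1
      = ((-h : ℝ) : ℂ) := by
    push_cast
    ring
  rw [this, Complex.norm_real, norm_eq_abs, sq_abs, neg_sq]

lemma szego_gagliardo_integrand_scaling {s ρ : ℝ} (hρ : 0 < ρ) (u : ℝ) {v : ℝ} (hv : v ≠ 0) :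
    ‖(1 : ℂ) / (((ρ * u + ρ * v : ℝ) : ℂ) + (ρ : ℂ) * Complex.I)
        - (1 : ℂ) / (((ρ * u : ℝ) : ℂ) + (ρ : ℂ) * Complex.I)‖ ^ 2 * |ρ * v| ^ (-1 - s)
      = ρ ^ (-1 - s) / ρ ^ 2
        * (|v| ^ (1 - s) / (((u + v) ^ 2 + 1) * (u ^ 2 + 1))) := by
  have hv' : 0 < |v| := abs_pos.2 hv
  rw [norm_szego_profile_sub_sq hρ, abs_mul, abs_of_pos hρ, mul_rpow hρ.le hv'.le,
    show 1 - s = 2 + (-1 - s) by ring, rpow_add hv', rpow_two, sq_abs]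
  have h1 : (ρ * u + ρ * v) ^ 2 + ρ ^ 2 = ρ ^ 2 * ((u + v) ^ 2 + 1) := by ring
  have h2 : (ρ * u) ^ 2 + ρ ^ 2 = ρ ^ 2 * (u ^ 2 + 1) := by ring
  rw [h1, h2]
  field_simp

lemma integral_eq_mul_integral_comp_mul_left {ρ : ℝ} (hρ : 0 < ρ) (g : ℝ → ℝ) :
    ∫ x, g x = ρ * ∫ x, g (ρ * x) := by
  rw [Measure.integral_comp_mul_left, abs_of_pos (inv_pos.2 hρ), smul_eq_mul,
    mul_inv_cancel_left₀ hρ.ne']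

/-- For `0 < s < 2`, the constant
`C(s) = ∫∫ |v|^{1-s} / (((u+v)²+1)(u²+1)) du dv` is finite (the integrand is
integrable on `ℝ²`) and positive, and the Gagliardo seminorm of order `s/2` of
`K_ρ(y) = 1/(y+iρ)` satisfies
`∫∫ |K_ρ(y+h) − K_ρ(y)|² |h|^{-1-s} dh dy = C(s) ρ^{-1-s}` for every `ρ > 0`. -/
theorem szego_profile_gagliardo_scaling (s : ℝ) (hs0 : 0 < s) (hs2 : s < 2) :
    Integrable (fun p : ℝ × ℝ =>
      |p.2| ^ (1 - s) / (((p.1 + p.2) ^ 2 + 1) * (p.1 ^ 2 + 1))) ∧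
    0 < (∫ p : ℝ × ℝ, |p.2| ^ (1 - s) / (((p.1 + p.2) ^ 2 + 1) * (p.1 ^ 2 + 1))) ∧
    ∀ ρ : ℝ, 0 < ρ →
      (∫ y : ℝ, ∫ h : ℝ,
          ‖(1 : ℂ) / (((y + h : ℝ) : ℂ) + (ρ : ℂ) * Complex.I)
            - (1 : ℂ) / ((y : ℂ) + (ρ : ℂ) * Complex.I)‖ ^ 2 * |h| ^ (-1 - s))
        = (∫ p : ℝ × ℝ, |p.2| ^ (1 - s) / (((p.1 + p.2) ^ 2 + 1) * (p.1 ^ 2 + 1)))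
            * ρ ^ (-1 - s) := by
  refine ⟨integrable_szego_gagliardo_kernel hs0 hs2, integral_szego_gagliardo_kernel_pos hs0 hs2,
    fun ρ hρ => ?_⟩
  have hinner : ∀ u : ℝ, (∫ h : ℝ,
        ‖(1 : ℂ) / (((ρ * u + h : ℝ) : ℂ) + (ρ : ℂ) * Complex.I)
          - (1 : ℂ) / (((ρ * u : ℝ) : ℂ) + (ρ : ℂ) * Complex.I)‖ ^ 2 * |h| ^ (-1 - s))
      = ρ * (ρ ^ (-1 - s) / ρ ^ 2
        * ∫ v : ℝ, |v| ^ (1 - s) / (((u + v) ^ 2 + 1) * (u ^ 2 + 1))) := fun u => by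
    rw [integral_eq_mul_integral_comp_mul_left hρ,
      ← integral_const_mul (ρ ^ (-1 - s) / ρ ^ 2)]
    congr 1
    apply integral_congr_ae
    filter_upwards [compl_mem_ae_iff.2 (measure_singleton (0 : ℝ))] with v hv
    exact szego_gagliardo_integrand_scaling hρ u hv
  rw [integral_eq_mul_integral_comp_mul_left hρ]
  simp_rw [hinner]
  rw [integral_const_mul, integral_const_mul, Measure.volume_eq_prod,
    integral_prod _ (integrable_szego_gagliardo_kernel hs0 hs2)]
  field_simp
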